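/- arXiv:quant-ph/0406233 — 3 statements merged into one kernel-verified Lean document; each statement's English description precedes it below -/
import Mathlib

section
/- Let U = [[a,b],[c,d]] be a 2×2 complex unitary matrix, P = [[a,b],[0,0]], Q = [[0,0],[c,d]], and let N ≥ 1. Define the block matrix Ū indexed by ℤ/(2N+1) (with 2×2 blocks): the block in row j and column j+1 (mod 2N+1) is P, the block in row j and column j−1 (mod 2N+1) is Q, and all other blocks are zero. Then Ū is a unitary matrix of size 2(2N+1). -/
open Matrix

/-- The shift of a quantum walk on a cyclic group of positions: the component `0` of the chirality
moves by `+1`, the component `1` moves by `-1`. -/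
def walkShift (R : Type*) [AddGroupWithOne R] : R × Fin 2 ≃ R × Fin 2 :=
  (Equiv.prodComm _ _).trans <|
    (Equiv.prodShear (Equiv.refl (Fin 2)) fun i => Equiv.addRight (![1, -1] i)).trans
      (Equiv.prodComm _ _)

theorem submatrix_equiv_id_mem_unitaryGroup {n α : Type*} [Fintype n] [DecidableEq n]
    [CommRing α] [StarRing α] {A : Matrix n n α} (hA : A ∈ unitaryGroup n α) (e : n ≃ n) :
    A.submatrix e id ∈ unitaryGroup n α := by
  rw [mem_unitaryGroup_iff, star_eq_conjTranspose] at hA ⊢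
  rw [conjTranspose_submatrix, ← Equiv.coe_refl, submatrix_mul_equiv, hA, submatrix_one_equiv]

theorem ZMod.add_one_ne_sub_one {n : ℕ} (hn : 3 ≤ n) (j : ZMod n) : j + 1 ≠ j - 1 := by
  intro h
  have h2 : ((2 : ℕ) : ZMod n) = 0 := by
    push_cast
    linear_combination h
  have := Nat.le_of_dvd two_pos ((ZMod.natCast_eq_zero_iff 2 n).1 h2)
  omega

/-- The one-step evolution matrix `Ū` of the quantum walk on the cycle `ℤ/(2N+1)`:
the 2×2 block in block-row `j`, block-column `j+1` is `P = !![a,b;0,0]`, the block in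
block-row `j`, block-column `j−1` is `Q = !![0,0;c,d]`, all other blocks vanish.
If `U = !![a,b;c,d]` is unitary and `N ≥ 1`, then `Ū` is a unitary matrix of size
`2(2N+1)` (here realized as a matrix indexed by `ZMod (2N+1) × Fin 2`). -/
theorem barU_unitary (N : ℕ) (hN : 1 ≤ N) (a b c d : ℂ)
    (hU : !![a, b; c, d] ∈ Matrix.unitaryGroup (Fin 2) ℂ) :
    (Matrix.of fun p q : ZMod (2 * N + 1) × Fin 2 =>
        if q.1 = p.1 + 1 then !![a, b; (0 : ℂ), 0] p.2 q.2
        else if q.1 = p.1 - 1 then !![(0 : ℂ), 0; c, d] p.2 q.2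
        else 0)
      ∈ Matrix.unitaryGroup (ZMod (2 * N + 1) × Fin 2) ℂ := by
  have hK := submatrix_equiv_id_mem_unitaryGroup
    (kronecker_mem_unitary (one_mem (unitaryGroup (ZMod (2 * N + 1)) ℂ)) hU)
    (walkShift (ZMod (2 * N + 1)))
  convert hK using 1
  ext ⟨j, i⟩ ⟨k, l⟩
  have hne := ZMod.add_one_ne_sub_one (show 3 ≤ 2 * N + 1 by omega) j
  fin_cases i
  · by_cases hk : k = j + 1
    · subst hk
      fin_cases l <;> simp [walkShift]
    · fin_cases l <;> simp [walkShift, hk, one_apply, Ne.symm hk]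
  · by_cases hk : k = j - 1
    · subst hk
      fin_cases l <;> simp [walkShift, hne.symm, ← sub_eq_add_neg]
    · fin_cases l <;> simp [walkShift, hk, one_apply, Ne.symm hk, ← sub_eq_add_neg]
end

section
/- Let U_1, …, U_n be 2×2 complex matrices, U_j = [[a_j,b_j],[c_j,d_j]], with P_j = [[a_j,b_j],[0,0]] and Q_j = [[0,0],[c_j,d_j]]. For integers l, m ≥ 0 with l + m = n, define Ξ_n(l,m) as the sum, over all subsets T of {1,…,n} of cardinality m, of the ordered products M_n · M_{n−1} ⋯ M_1 where M_j = Q_j if j ∈ T and M_j = P_j otherwise. If each U_j is unitary, then for any vector φ ∈ ℂ² with |φ₁|² + |φ₂|² = 1, the sum over k ∈ {−n, −n+2, …, n−2, n} of ‖Ξ_n((n−k)/2, (n+k)/2) φ‖² equals 1. -/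
open Matrix Finset

/-- `Xi P Q n m` is `Ξ_n(l,m)` (with `l = n − m`): the sum, over all subsets `T` of
`{1,…,n}` of cardinality `m`, of the ordered products `M_n · M_{n−1} ⋯ M_1` where
`M_j = Q j` if `j ∈ T` and `M_j = P j` otherwise (largest index leftmost). -/
noncomputable def Xi (P Q : ℕ → Matrix (Fin 2) (Fin 2) ℂ) (n m : ℕ) : Matrix (Fin 2) (Fin 2) ℂ :=
  ∑ T ∈ (Finset.Icc 1 n).powersetCard m,
    ((List.range n).reverse.map (fun i => if i + 1 ∈ T then Q (i + 1) else P (i + 1))).prod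

theorem Xi_zero_zero (P Q : ℕ → Matrix (Fin 2) (Fin 2) ℂ) : Xi P Q 0 0 = 1 := by
  simp [Xi]

theorem Xi_eq_zero_of_lt (P Q : ℕ → Matrix (Fin 2) (Fin 2) ℂ) {n m : ℕ} (h : n < m) :
    Xi P Q n m = 0 := by
  rw [Xi, Finset.powersetCard_eq_empty.2 (by simpa using h), Finset.sum_empty]

theorem prod_reverse_range_succ_of_mem (P Q : ℕ → Matrix (Fin 2) (Fin 2) ℂ) (n : ℕ)
    (T : Finset ℕ) :
    ((List.range (n + 1)).reverse.map
        (fun i => if i + 1 ∈ insert (n + 1) T then Q (i + 1) else P (i + 1))).prod =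
      Q (n + 1) *
        ((List.range n).reverse.map (fun i => if i + 1 ∈ T then Q (i + 1) else P (i + 1))).prod := by
  rw [List.range_succ, List.reverse_append, List.reverse_singleton, List.singleton_append,
    List.map_cons, List.prod_cons, if_pos (Finset.mem_insert_self _ _)]
  congr 2
  refine List.map_congr_left fun i hi => ?_
  have hi : i < n := by simpa using hi
  simp [hi.ne]

theorem prod_reverse_range_succ_of_notMem (P Q : ℕ → Matrix (Fin 2) (Fin 2) ℂ) (n : ℕ)
    {T : Finset ℕ} (hT : n + 1 ∉ T) :
    ((List.range (n + 1)).reverse.map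
        (fun i => if i + 1 ∈ T then Q (i + 1) else P (i + 1))).prod =
      P (n + 1) *
        ((List.range n).reverse.map (fun i => if i + 1 ∈ T then Q (i + 1) else P (i + 1))).prod := by
  rw [List.range_succ, List.reverse_append, List.reverse_singleton, List.singleton_append,
    List.map_cons, List.prod_cons, if_neg hT]

theorem notMem_of_mem_powersetCard_Icc {n m : ℕ} {T : Finset ℕ}
    (hT : T ∈ (Finset.Icc 1 n).powersetCard m) : n + 1 ∉ T := fun h => by
  have := Finset.mem_Icc.1 ((Finset.mem_powersetCard.1 hT).1 h)
  omega

theorem Xi_succ_zero (P Q : ℕ → Matrix (Fin 2) (Fin 2) ℂ) (n : ℕ) :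
    Xi P Q (n + 1) 0 = P (n + 1) * Xi P Q n 0 := by
  simp only [Xi, Finset.powersetCard_zero, Finset.sum_singleton]
  exact prod_reverse_range_succ_of_notMem P Q n (Finset.notMem_empty _)

theorem Xi_succ_succ (P Q : ℕ → Matrix (Fin 2) (Fin 2) ℂ) (n m : ℕ) :
    Xi P Q (n + 1) (m + 1) = P (n + 1) * Xi P Q n (m + 1) + Q (n + 1) * Xi P Q n m := by
  have hn : n + 1 ∉ Finset.Icc 1 n := by simp
  have hI : Finset.Icc 1 (n + 1) = insert (n + 1) (Finset.Icc 1 n) := by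
    ext i
    simp only [Finset.mem_Icc, Finset.mem_insert]
    omega
  unfold Xi
  rw [hI, Finset.powersetCard_succ_insert hn, Finset.sum_union, Finset.sum_image,
    Finset.mul_sum, Finset.mul_sum]
  · congr 1
    · exact Finset.sum_congr rfl fun T hT =>
        prod_reverse_range_succ_of_notMem P Q n (notMem_of_mem_powersetCard_Icc hT)
    · exact Finset.sum_congr rfl fun T _ => prod_reverse_range_succ_of_mem P Q n T
  · intro S hS T hT h
    rw [← Finset.erase_insert (notMem_of_mem_powersetCard_Icc hS),
      ← Finset.erase_insert (notMem_of_mem_powersetCard_Icc hT), h]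
  · rw [Finset.disjoint_left]
    intro T hT hT'
    obtain ⟨S, -, rfl⟩ := Finset.mem_image.1 hT'
    exact notMem_of_mem_powersetCard_Icc hT (Finset.mem_insert_self _ _)

theorem norm_sq_mulVec_of_mem_unitaryGroup {U : Matrix (Fin 2) (Fin 2) ℂ}
    (hU : U ∈ Matrix.unitaryGroup (Fin 2) ℂ) (v : Fin 2 → ℂ) :
    ‖(U *ᵥ v) 0‖ ^ 2 + ‖(U *ᵥ v) 1‖ ^ 2 = ‖v 0‖ ^ 2 + ‖v 1‖ ^ 2 := by
  have key : ∀ w : Fin 2 → ℂ, star w ⬝ᵥ w = ((‖w 0‖ ^ 2 + ‖w 1‖ ^ 2 : ℝ) : ℂ) := fun w => by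
    simp [dotProduct, Fin.sum_univ_two, Complex.conj_mul']
  have h : star (U *ᵥ v) ⬝ᵥ (U *ᵥ v) = star v ⬝ᵥ v := by
    rw [Matrix.star_mulVec, Matrix.dotProduct_mulVec, Matrix.vecMul_vecMul,
      ← Matrix.star_eq_conjTranspose, Matrix.mem_unitaryGroup_iff'.1 hU, Matrix.vecMul_one]
  rw [key, key] at h
  exact_mod_cast h

theorem sum_range_norm_sq_Xi_mulVec (a b c d : ℕ → ℂ) (φ : Fin 2 → ℂ) (n : ℕ)
    (hU : ∀ j ∈ Finset.Icc 1 n, !![a j, b j; c j, d j] ∈ Matrix.unitaryGroup (Fin 2) ℂ) :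
    ∑ m ∈ Finset.range (n + 1),
      (‖(Xi (fun j => !![a j, b j; 0, 0]) (fun j => !![0, 0; c j, d j]) n m *ᵥ φ) 0‖ ^ 2 +
       ‖(Xi (fun j => !![a j, b j; 0, 0]) (fun j => !![0, 0; c j, d j]) n m *ᵥ φ) 1‖ ^ 2) =
      ‖φ 0‖ ^ 2 + ‖φ 1‖ ^ 2 := by
  induction n with
  | zero => simp [Xi_zero_zero]
  | succ n ih =>
    rw [← ih fun j hj => hU j (Finset.Icc_subset_Icc_right n.le_succ hj)]
    set P : ℕ → Matrix (Fin 2) (Fin 2) ℂ := fun j => !![a j, b j; 0, 0] with hP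
    set Q : ℕ → Matrix (Fin 2) (Fin 2) ℂ := fun j => !![0, 0; c j, d j] with hQ
    set U : Matrix (Fin 2) (Fin 2) ℂ := !![a (n + 1), b (n + 1); c (n + 1), d (n + 1)] with hUdef
    have hUn : U ∈ Matrix.unitaryGroup (Fin 2) ℂ := hU (n + 1) (by simp)
    have hP0 (v : Fin 2 → ℂ) : (P (n + 1) *ᵥ v) 0 = (U *ᵥ v) 0 := by
      simp [hP, hUdef]
    have hP1 (v : Fin 2 → ℂ) : (P (n + 1) *ᵥ v) 1 = 0 := by
      simp [hP]
    have hQ0 (v : Fin 2 → ℂ) : (Q (n + 1) *ᵥ v) 0 = 0 := by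
      simp [hQ]
    have hQ1 (v : Fin 2 → ℂ) : (Q (n + 1) *ᵥ v) 1 = (U *ᵥ v) 1 := by
      simp [hQ, hUdef]
    have h0 (m : ℕ) : (Xi P Q (n + 1) m *ᵥ φ) 0 = (U *ᵥ (Xi P Q n m *ᵥ φ)) 0 := by
      cases m with
      | zero => rw [Xi_succ_zero, ← Matrix.mulVec_mulVec, hP0]
      | succ m =>
        rw [Xi_succ_succ, Matrix.add_mulVec, ← Matrix.mulVec_mulVec, ← Matrix.mulVec_mulVec,
          Pi.add_apply, hP0, hQ0, add_zero]
    have h10 : (Xi P Q (n + 1) 0 *ᵥ φ) 1 = 0 := by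
      rw [Xi_succ_zero, ← Matrix.mulVec_mulVec, hP1]
    have h1 (m : ℕ) : (Xi P Q (n + 1) (m + 1) *ᵥ φ) 1 = (U *ᵥ (Xi P Q n m *ᵥ φ)) 1 := by
      rw [Xi_succ_succ, Matrix.add_mulVec, ← Matrix.mulVec_mulVec, ← Matrix.mulVec_mulVec,
        Pi.add_apply, hP1, hQ1, zero_add]
    rw [Finset.sum_add_distrib, Finset.sum_range_succ, h0 (n + 1),
      Xi_eq_zero_of_lt P Q n.lt_succ_self, Finset.sum_range_succ' _ (n + 1), h10]
    simp only [h0, h1, Matrix.zero_mulVec, Matrix.mulVec_zero, Pi.zero_apply, norm_zero, ne_eq,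
      OfNat.ofNat_ne_zero, not_false_eq_true, zero_pow, add_zero]
    rw [← Finset.sum_add_distrib]
    exact Finset.sum_congr rfl fun m _ => norm_sq_mulVec_of_mem_unitaryGroup hUn _

theorem sum_Icc_neg_filter_even (n : ℕ) (f : ℕ → ℝ) :
    ∑ k ∈ (Finset.Icc (-(n : ℤ)) (n : ℤ)).filter (fun k => ((n : ℤ) + k) % 2 = 0),
      f (((n : ℤ) + k) / 2).toNat = ∑ m ∈ Finset.range (n + 1), f m := by
  refine Finset.sum_bij' (fun k _ => (((n : ℤ) + k) / 2).toNat) (fun m _ => 2 * (m : ℤ) - n)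
    ?_ ?_ ?_ ?_ fun _ _ => rfl <;>
  · simp only [Finset.mem_filter, Finset.mem_Icc, Finset.mem_range]
    omega

/-- If each coin `U_j = !![a_j,b_j;c_j,d_j]`, `1 ≤ j ≤ n`, is unitary, then for any unit
vector `φ ∈ ℂ²`, the quantities `‖Ξ_n((n−k)/2,(n+k)/2) φ‖²` summed over
`k ∈ {−n, −n+2, …, n−2, n}` equal `1` (the amplitudes define a probability
distribution for the location of the walker at time `n`). -/
theorem Xi_prob_dist (n : ℕ) (a b c d : ℕ → ℂ)
    (hU : ∀ j ∈ Finset.Icc 1 n, !![a j, b j; c j, d j] ∈ Matrix.unitaryGroup (Fin 2) ℂ)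
    (φ : Fin 2 → ℂ) (hφ : ‖φ 0‖ ^ 2 + ‖φ 1‖ ^ 2 = 1) :
    ∑ k ∈ (Finset.Icc (-(n : ℤ)) (n : ℤ)).filter (fun k => ((n : ℤ) + k) % 2 = 0),
      (‖((Xi (fun j => !![a j, b j; (0:ℂ), 0]) (fun j => !![(0:ℂ), 0; c j, d j])
            n (((n : ℤ) + k) / 2).toNat).mulVec φ) 0‖ ^ 2 +
       ‖((Xi (fun j => !![a j, b j; (0:ℂ), 0]) (fun j => !![(0:ℂ), 0; c j, d j])
            n (((n : ℤ) + k) / 2).toNat).mulVec φ) 1‖ ^ 2) = 1 := by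
  exact (sum_Icc_neg_filter_even n _).trans ((sum_range_norm_sq_Xi_mulVec a b c d φ n hU).trans hφ)
end

section
/- Define μ : (0, ∞) → ℝ by μ(σ) = 1/6 + (1/3)·(1 − 4σ²)·e^{−2σ²}. Then for every σ > 0, 0 < μ(√3/2) ≤ μ(σ) ≤ 1/2; moreover μ(σ) tends to 1/2 as σ tends to 0 from the right. In particular μ(σ) ≠ 0 for all σ > 0, so the coin of Shapira et al. never satisfies the condition E(a₁·conj(c₁)) = 0. -/
open Real Filter

/-- The function `t ↦ (1 - 4t)e^{-2t}` is minimal at `t = 3/4`. -/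
lemma neg_two_mul_exp_le_one_sub_four_mul_mul_exp (t : ℝ) :
    -2 * Real.exp (-(3 / 2)) ≤ (1 - 4 * t) * Real.exp (-2 * t) := by
  have hsplit : Real.exp (-(3 / 2)) = Real.exp (2 * t - 3 / 2) * Real.exp (-2 * t) := by
    rw [← Real.exp_add]
    ring_nf
  rw [hsplit]
  nlinarith [Real.exp_pos (-2 * t), Real.add_one_le_exp (2 * t - 3 / 2)]

lemma exp_neg_three_halves_lt : Real.exp (-(3 / 2)) < 1 / 4 := by
  have hcube : Real.exp (3 / 2) ^ 2 = Real.exp 1 ^ 3 := by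
    rw [← Real.exp_nat_mul, ← Real.exp_nat_mul]
    norm_num
  have he : (2.7 : ℝ) ^ 3 < Real.exp 1 ^ 3 :=
    pow_lt_pow_left₀ (by linarith [Real.exp_one_gt_d9]) (by norm_num) (by norm_num)
  have hfour : 4 < Real.exp (3 / 2) := by
    nlinarith [Real.exp_pos (3 / 2)]
  rw [Real.exp_neg, ← one_div]
  exact one_div_lt_one_div_of_lt (by norm_num) hfour

/-- Properties of `μ(σ) = 1/6 + (1/3)(1 − 4σ²)e^{−2σ²}`, the value of `E(a₁·conj c₁)` for
the coin of Shapira et al.: for all `σ > 0`,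
`0 < μ(√3/2) ≤ μ(σ) ≤ 1/2`; `μ(σ) → 1/2` as `σ ↓ 0`; and `μ(σ) ≠ 0` for all `σ > 0`,
so this coin never satisfies the condition `E(a₁·conj c₁) = 0`. -/
theorem shapira_mu_properties :
    (0 < 1 / 6 + (1 / 3) * (1 - 4 * (Real.sqrt 3 / 2) ^ 2)
        * Real.exp (-2 * (Real.sqrt 3 / 2) ^ 2)) ∧
    (∀ σ : ℝ, 0 < σ →
      1 / 6 + (1 / 3) * (1 - 4 * (Real.sqrt 3 / 2) ^ 2) * Real.exp (-2 * (Real.sqrt 3 / 2) ^ 2)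
        ≤ 1 / 6 + (1 / 3) * (1 - 4 * σ ^ 2) * Real.exp (-2 * σ ^ 2)) ∧
    (∀ σ : ℝ, 0 < σ →
      1 / 6 + (1 / 3) * (1 - 4 * σ ^ 2) * Real.exp (-2 * σ ^ 2) ≤ 1 / 2) ∧
    Tendsto (fun σ : ℝ => 1 / 6 + (1 / 3) * (1 - 4 * σ ^ 2) * Real.exp (-2 * σ ^ 2))
      (nhdsWithin 0 (Set.Ioi 0)) (nhds (1 / 2)) ∧
    (∀ σ : ℝ, 0 < σ →
      1 / 6 + (1 / 3) * (1 - 4 * σ ^ 2) * Real.exp (-2 * σ ^ 2) ≠ 0) := by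
  have hsq : (Real.sqrt 3 / 2) ^ 2 = 3 / 4 := by
    rw [div_pow, Real.sq_sqrt (by norm_num)]
    norm_num
  have hexp : Real.exp (-2 * (3 / 4)) = Real.exp (-(3 / 2)) := by norm_num
  rw [hsq, hexp]
  refine ⟨?_, fun σ _ => ?_, fun σ _ => ?_, ?_, fun σ _ => ?_⟩
  · linarith [exp_neg_three_halves_lt]
  · linarith [neg_two_mul_exp_le_one_sub_four_mul_mul_exp (σ ^ 2)]
  · have hle : Real.exp (-2 * σ ^ 2) ≤ 1 := Real.exp_le_one_iff.2 (by nlinarith [sq_nonneg σ])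
    nlinarith [mul_nonneg (sq_nonneg σ) (Real.exp_pos (-2 * σ ^ 2)).le]
  · have hcont : Continuous fun σ : ℝ =>
        1 / 6 + (1 / 3) * (1 - 4 * σ ^ 2) * Real.exp (-2 * σ ^ 2) := by fun_prop
    refine (hcont.tendsto' 0 (1 / 2) ?_).mono_left nhdsWithin_le_nhds
    norm_num
  · refine ne_of_gt ?_
    linarith [exp_neg_three_halves_lt, neg_two_mul_exp_le_one_sub_four_mul_mul_exp (σ ^ 2)]
end
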